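/- Let d ≥ 1, α ∈ [1,2), μ ∈ (0,1), and c_0, K > 0. Suppose the kernel ρ satisfies Assumption S(c_0), the pair (ρ,G) satisfies Assumption A(K,c_0), and |ρ(y) − ρ(z)| ≤ K|y − z|^μ for all |y| = |z| = 1. Define m(x,y) = ρ(G(x)^{-1} y) / ( |det G(x)| · |G(x)^{-1}(y/|y|)|^{d+α} ) for x ∈ ℝ^d, y ∈ ℝ^d∖{0}. Then there is a constant C = C(d, α, μ, K, c_0) such that |m(x+h, y) − m(x, y)| ≤ C|h|^μ for all x, h ∈ ℝ^d and all y ≠ 0; that is, m(·, y) is μ-Hölder continuous uniformly over y. -/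

import Mathlib

open Set

noncomputable section

/-- `ℝ^d` with the Euclidean norm. -/
abbrev Euc (d : ℕ) := EuclideanSpace ℝ (Fin d)

/-- The continuous linear map on `ℝ^d` induced by a `d × d` real matrix. -/
noncomputable def matCLM {d : ℕ} (A : Matrix (Fin d) (Fin d) ℝ) :
    Euc d →L[ℝ] Euc d :=
  Matrix.toEuclideanCLM (𝕜 := ℝ) A

/-- Assumption S(c₀): `ρ ≥ c₀ > 0`, `ρ` is `0`-homogeneous, and `ρ` is even if `α = 1`. -/
def AssumpS (d : ℕ) (α c0 : ℝ) (ρ : Euc d → ℝ) : Prop :=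
  (∀ y : Euc d, y ≠ 0 → c0 ≤ ρ y) ∧
  (∀ l : ℝ, 0 < l → ∀ y : Euc d, y ≠ 0 → ρ (l • y) = ρ y) ∧
  (α = 1 → ∀ y : Euc d, y ≠ 0 → ρ (-y) = ρ y)

/-- Assumption A(K,c₀): S(c₀) holds, `|det G(x)| ≥ c₀`, the operator norms of `G(x)` and
the Lipschitz constant of `G` are bounded by `K`, and `0 ≤ ρ ≤ K`. -/
def AssumpA (d : ℕ) (α K c0 : ℝ) (ρ : Euc d → ℝ)
    (G : Euc d → Matrix (Fin d) (Fin d) ℝ) : Prop :=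
  AssumpS d α c0 ρ ∧
  (∀ x : Euc d, c0 ≤ |(G x).det|) ∧
  (∀ x : Euc d, ‖matCLM (G x)‖ ≤ K) ∧
  (∀ x x' : Euc d, ‖matCLM (G x) - matCLM (G x')‖ ≤ K * ‖x - x'‖) ∧
  (∀ y : Euc d, y ≠ 0 → 0 ≤ ρ y ∧ ρ y ≤ K)

/-- The kernel `m(x,y) = ρ(G(x)⁻¹y) / ( |det G(x)| · |G(x)⁻¹(y/|y|)|^{d+α} )`. -/
noncomputable def mker (d : ℕ) (α : ℝ) (ρ : Euc d → ℝ)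
    (G : Euc d → Matrix (Fin d) (Fin d) ℝ) (x y : Euc d) : ℝ :=
  ρ (matCLM (G x)⁻¹ y) /
    (|(G x).det| * ‖matCLM (G x)⁻¹ (‖y‖⁻¹ • y)‖ ^ ((d : ℝ) + α))

lemma matCLM_mul {d : ℕ} (A B : Matrix (Fin d) (Fin d) ℝ) (v : Euc d) :
    matCLM (A * B) v = matCLM A (matCLM B v) := by
  simp [matCLM]

lemma matCLM_inv_bound (d : ℕ) (c0 K : ℝ) (hc0 : 0 < c0) :
    ∃ M : ℝ, 0 < M ∧ ∀ A : Matrix (Fin d) (Fin d) ℝ, ‖matCLM A‖ ≤ K → c0 ≤ |A.det| →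
      ‖matCLM A⁻¹‖ ≤ M := by
  let T := (Matrix.toEuclideanCLM (n := Fin d) (𝕜 := ℝ)).toAlgEquiv.toLinearEquiv
  have hT : Continuous T := T.toLinearMap.continuous_of_finiteDimensional
  have hTs : Continuous T.symm := T.symm.toLinearMap.continuous_of_finiteDimensional
  have : ProperSpace (Euc d →L[ℝ] Euc d) := FiniteDimensional.proper ℝ _
  have hc : Continuous fun L : Euc d →L[ℝ] Euc d => ‖T (T.symm L).adjugate‖ :=
    (hT.comp hTs.matrix_adjugate).norm
  obtain ⟨M, hM⟩ := (isCompact_closedBall (0 : Euc d →L[ℝ] Euc d) K).bddAbove_image hc.continuousOn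
  refine ⟨|M| / c0 + 1, by positivity, fun A hA hdet => ?_⟩
  have h1 : ‖matCLM A.adjugate‖ ≤ M := by
    apply hM
    refine ⟨matCLM A, by simpa using hA, ?_⟩
    have : T.symm (matCLM A) = A := T.symm_apply_apply A
    simp only [this]
    rfl
  have h2 : matCLM A⁻¹ = (A.det)⁻¹ • matCLM A.adjugate := by
    rw [Matrix.inv_def, Ring.inverse_eq_inv']
    simp [matCLM]
  rw [h2, norm_smul, norm_inv, Real.norm_eq_abs]
  have h3 : |A.det|⁻¹ ≤ c0⁻¹ := inv_anti₀ hc0 hdet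
  calc |A.det|⁻¹ * ‖matCLM A.adjugate‖ ≤ c0⁻¹ * |M| :=
        mul_le_mul h3 (h1.trans (le_abs_self M)) (norm_nonneg _) (by positivity)
    _ ≤ |M| / c0 + 1 := by rw [div_eq_inv_mul]; linarith

lemma det_lip (d : ℕ) (K : ℝ) :
    ∃ L : ℝ, 0 < L ∧ ∀ A B : Matrix (Fin d) (Fin d) ℝ, ‖matCLM A‖ ≤ K → ‖matCLM B‖ ≤ K →
      |A.det - B.det| ≤ L * ‖matCLM A - matCLM B‖ := by
  let T := (Matrix.toEuclideanCLM (n := Fin d) (𝕜 := ℝ)).toAlgEquiv.toLinearEquiv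
  have : ProperSpace (Euc d →L[ℝ] Euc d) := FiniteDimensional.proper ℝ _
  have hc : ContDiff ℝ 1 fun L : Euc d →L[ℝ] Euc d => (T.symm L).det := by
    simp only [Matrix.det_apply']
    refine ContDiff.sum fun σ _ => contDiff_const.mul (contDiff_prod fun i _ => ?_)
    let ℓ : (Euc d →L[ℝ] Euc d) →ₗ[ℝ] ℝ :=
      { toFun := fun L => T.symm L (σ i) i
        map_add' := fun a b => by simp
        map_smul' := fun a b => by simp }
    exact (LinearMap.toContinuousLinearMap ℓ).contDiff
  obtain ⟨L, hL⟩ := hc.contDiffOn.exists_lipschitzOnWith one_ne_zero (convex_closedBall (0 : Euc d →L[ℝ] Euc d) K) (isCompact_closedBall _ _)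
  refine ⟨L + 1, by positivity, fun A B hA hB => ?_⟩
  have := hL.norm_sub_le (x := matCLM A) (y := matCLM B) (by simpa using hA) (by simpa using hB)
  have hA' : T.symm (matCLM A) = A := T.symm_apply_apply A
  have hB' : T.symm (matCLM B) = B := T.symm_apply_apply B
  simp only [hA', hB', Real.norm_eq_abs] at this
  nlinarith [norm_nonneg (matCLM A - matCLM B)]

lemma rpow_lip (a b p : ℝ) (ha : 0 < a) :
    ∃ L : ℝ, 0 < L ∧ ∀ s t : ℝ, s ∈ Icc a b → t ∈ Icc a b →
      |s ^ (-p) - t ^ (-p)| ≤ L * |s - t| := by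
  have hc : ContDiffOn ℝ 1 (fun s : ℝ => s ^ (-p)) (Icc a b) := by
    intro s hs
    exact (Real.contDiffAt_rpow_const_of_ne (ha.trans_le hs.1).ne').contDiffWithinAt
  obtain ⟨L, hL⟩ := hc.exists_lipschitzOnWith one_ne_zero (convex_Icc a b) isCompact_Icc
  refine ⟨L + 1, by positivity, fun s t hs ht => ?_⟩
  have := hL.norm_sub_le hs ht
  simp only [Real.norm_eq_abs] at this
  nlinarith [abs_nonneg (s - t)]

lemma unit_diff {E : Type*} [NormedAddCommGroup E] [NormedSpace ℝ E] (v w : E) (hv : v ≠ 0)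
    (hw : w ≠ 0) : ‖‖v‖⁻¹ • v - ‖w‖⁻¹ • w‖ ≤ 2 * ‖v‖⁻¹ * ‖v - w‖ := by
  have hv' := norm_pos_iff.2 hv
  have hw' := norm_pos_iff.2 hw
  have e : ‖v‖⁻¹ • v - ‖w‖⁻¹ • w = ‖v‖⁻¹ • (v - w) + (‖v‖⁻¹ * (‖w‖ - ‖v‖) * ‖w‖⁻¹) • w := by
    have : ‖v‖⁻¹ * (‖w‖ - ‖v‖) * ‖w‖⁻¹ = ‖v‖⁻¹ - ‖w‖⁻¹ := by field_simp
    rw [this]; module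
  rw [e]
  refine (norm_add_le _ _).trans ?_
  rw [norm_smul, norm_smul, norm_mul, norm_mul, norm_inv, norm_inv, norm_norm, norm_norm,
    mul_assoc _ _ ‖w‖, inv_mul_cancel₀ hw'.ne', mul_one]
  have : ‖‖w‖ - ‖v‖‖ ≤ ‖v - w‖ := by
    rw [norm_sub_rev v w]; exact abs_norm_sub_norm_le w v
  have := mul_le_mul_of_nonneg_left this (inv_nonneg.2 hv'.le)
  linarith

lemma prod3_diff (r r' D D' N N' K P Q a b c : ℝ) (hr' : |r'| ≤ K) (hr : |r| ≤ K)
    (hD : |D| ≤ P) (hN : |N| ≤ Q) (hD' : |D'| ≤ P)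
    (ha : |r - r'| ≤ a) (hb : |D - D'| ≤ b) (hc : |N - N'| ≤ c) :
    |r * D * N - r' * D' * N'| ≤ a * P * Q + K * b * Q + K * P * c := by
  have e : r * D * N - r' * D' * N' = (r - r') * D * N + r' * (D - D') * N
      + r' * D' * (N - N') := by ring
  rw [e]
  refine (abs_add_three _ _ _).trans ?_
  simp only [abs_mul]
  have := abs_nonneg (r - r')
  have := abs_nonneg (D - D')
  have := abs_nonneg r'
  have := abs_nonneg D
  have := abs_nonneg D'
  have := abs_nonneg N
  have := abs_nonneg (N - N')
  have := ha.trans' (abs_nonneg _)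
  have := hb.trans' (abs_nonneg _)
  have := hD.trans' (abs_nonneg _)
  have := hr'.trans' (abs_nonneg _)
  gcongr


/-- Everything needed about a single matrix. -/
lemma single (d : ℕ) (α c0 K M : ℝ) (hα : 0 ≤ (d : ℝ) + α) (hc0 : 0 < c0) (hK : 0 < K)
    (ρ : Euc d → ℝ) (G : Euc d → Matrix (Fin d) (Fin d) ℝ)
    (hM : ∀ A : Matrix (Fin d) (Fin d) ℝ, ‖matCLM A‖ ≤ K → c0 ≤ |A.det| → ‖matCLM A⁻¹‖ ≤ M)
    (hA : AssumpA d α K c0 ρ G) (x y : Euc d) (hy : y ≠ 0) :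
    let v := matCLM (G x)⁻¹ (‖y‖⁻¹ • y)
    v ≠ 0 ∧ K⁻¹ ≤ ‖v‖ ∧ ‖v‖ ≤ M ∧ matCLM (G x) v = ‖y‖⁻¹ • y ∧
      mker d α ρ G x y = ρ (‖v‖⁻¹ • v) * |(G x).det|⁻¹ * ‖v‖ ^ (-((d : ℝ) + α)) ∧
      |ρ (‖v‖⁻¹ • v)| ≤ K ∧ |(|(G x).det|⁻¹)| ≤ c0⁻¹ ∧
      |‖v‖ ^ (-((d : ℝ) + α))| ≤ K ^ ((d : ℝ) + α) := by
  intro v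
  obtain ⟨⟨-, hhom, -⟩, hdet, hG, -, hρ⟩ := hA
  have he : ‖‖y‖⁻¹ • y‖ = 1 := by
    rw [norm_smul, norm_inv, norm_norm, inv_mul_cancel₀ (norm_ne_zero_iff.2 hy)]
  have hu : IsUnit (G x).det := by
    rw [isUnit_iff_ne_zero, ← abs_pos]; exact hc0.trans_le (hdet x)
  have h4 : matCLM (G x) v = ‖y‖⁻¹ • y := by
    simp only [v]
    rw [← matCLM_mul, Matrix.mul_nonsing_inv _ hu]
    simp [matCLM]
  have h1 : 1 ≤ K * ‖v‖ := by
    rw [← he, ← h4]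
    exact (ContinuousLinearMap.le_opNorm _ _).trans
      (mul_le_mul_of_nonneg_right (hG x) (norm_nonneg _))
  have h2 : K⁻¹ ≤ ‖v‖ := by
    rwa [inv_le_iff_one_le_mul₀' hK]
  have hvpos : 0 < ‖v‖ := (inv_pos.2 hK).trans_le h2
  have hv : v ≠ 0 := norm_pos_iff.1 hvpos
  have hyn : 0 < ‖y‖ := norm_pos_iff.2 hy
  have hvn : ‖v‖⁻¹ • v ≠ 0 := smul_ne_zero (inv_pos.2 hvpos).ne' hv
  refine ⟨hv, h2, ?_, h4, ?_, ?_, ?_, ?_⟩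
  · have := ContinuousLinearMap.le_opNorm (matCLM (G x)⁻¹) (‖y‖⁻¹ • y)
    rw [he, mul_one] at this
    exact this.trans (hM _ (hG x) (hdet x))
  · have e1 : matCLM (G x)⁻¹ y = ‖y‖ • v := by
      simp only [v]
      rw [map_smul, smul_smul, mul_inv_cancel₀ hyn.ne', one_smul]
    rw [mker, e1, hhom _ hyn _ hv, hhom _ (inv_pos.2 hvpos) _ hv, Real.rpow_neg hvpos.le,
      div_eq_mul_inv, mul_inv, mul_assoc]
  · rw [abs_of_nonneg (hρ _ hvn).1]; exact (hρ _ hvn).2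
  · rw [abs_inv, abs_abs]; exact inv_anti₀ hc0 (hdet x)
  · rw [abs_of_nonneg (by positivity), Real.rpow_neg hvpos.le, ← Real.inv_rpow hvpos.le]
    exact Real.rpow_le_rpow (by positivity) (inv_le_of_inv_le₀ hK h2) hα

/-- under S(c₀), A(K,c₀) and `μ`-Hölder continuity of `ρ` on the unit
sphere, the kernel `m(·,y)` is `μ`-Hölder continuous uniformly over `y ≠ 0`, with a
constant `C = C(d, α, μ, K, c₀)`. -/
theorem statement6 (d : ℕ) (hd : 1 ≤ d) (α μ c0 K : ℝ)
    (hα : α ∈ Ico (1 : ℝ) 2) (hμ : μ ∈ Ioo (0 : ℝ) 1)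
    (hc0 : 0 < c0) (hK : 0 < K) :
    ∃ C : ℝ, 0 < C ∧
      ∀ (ρ : Euc d → ℝ) (G : Euc d → Matrix (Fin d) (Fin d) ℝ),
        AssumpS d α c0 ρ → AssumpA d α K c0 ρ G →
        (∀ y z : Euc d, ‖y‖ = 1 → ‖z‖ = 1 → |ρ y - ρ z| ≤ K * ‖y - z‖ ^ μ) →
        ∀ (x h y : Euc d), y ≠ 0 →
          |mker d α ρ G (x + h) y - mker d α ρ G x y| ≤ C * ‖h‖ ^ μ := by
  obtain ⟨M, hM0, hM⟩ := matCLM_inv_bound d c0 K hc0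
  obtain ⟨L1, hL10, hL1⟩ := det_lip d K
  obtain ⟨L2, hL20, hL2⟩ := rpow_lip K⁻¹ M ((d : ℝ) + α) (inv_pos.2 hK)
  have hp : 0 ≤ (d : ℝ) + α := by have := hα.1; positivity
  refine ⟨K * (2 * K * (M * (K * M))) ^ μ * c0⁻¹ * K ^ ((d : ℝ) + α)
    + K * (c0⁻¹ * c0⁻¹ * (L1 * K)) * K ^ ((d : ℝ) + α)
    + K * c0⁻¹ * (L2 * (M * (K * M))) + 6 * (K * c0⁻¹ * K ^ ((d : ℝ) + α)), by positivity, ?_⟩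
  intro ρ G _ hA hH x h y hy
  obtain ⟨hv, hv1, hv2, hv3, hv4, hv5, hv6, hv7⟩ := single d α c0 K M hp hc0 hK ρ G hM hA (x + h) y hy
  obtain ⟨hw, hw1, hw2, hw3, hw4, hw5, hw6, hw7⟩ := single d α c0 K M hp hc0 hK ρ G hM hA x y hy
  have hvdef : matCLM (G (x + h))⁻¹ (‖y‖⁻¹ • y) = matCLM (G (x + h))⁻¹ (‖y‖⁻¹ • y) := rfl
  generalize hve : matCLM (G (x + h))⁻¹ (‖y‖⁻¹ • y) = v at *
  generalize hwe : matCLM (G x)⁻¹ (‖y‖⁻¹ • y) = w at *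
  obtain ⟨-, hdet, hG, hLip, -⟩ := hA
  rw [hv4, hw4]
  have hhn := norm_nonneg h
  rcases le_total ‖h‖ 1 with h1 | h1
  · have hGl : ‖matCLM (G (x + h)) - matCLM (G x)‖ ≤ K * ‖h‖ := by
      simpa using hLip (x + h) x
    have hpow : ‖h‖ ≤ ‖h‖ ^ μ := Real.self_le_rpow_of_le_one hhn h1 hμ.2.le
    have hvw : ‖v - w‖ ≤ M * (K * M) * ‖h‖ := by
      have hu : IsUnit (G x).det := by
        rw [isUnit_iff_ne_zero, ← abs_pos]; exact hc0.trans_le (hdet x)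
      have e : v - w = - matCLM (G x)⁻¹ ((matCLM (G (x + h)) - matCLM (G x)) v) := by
        rw [sub_apply, map_sub, hv3, hwe, ← matCLM_mul, Matrix.nonsing_inv_mul _ hu]
        simp [matCLM]
      rw [e, norm_neg]
      calc _ ≤ M * ((K * ‖h‖) * M) := by
            refine (ContinuousLinearMap.le_opNorm _ _).trans ?_
            refine mul_le_mul (hM _ (hG x) (hdet x)) ?_ (norm_nonneg _) hM0.le
            refine (ContinuousLinearMap.le_opNorm _ _).trans ?_
            exact mul_le_mul hGl hv2 (norm_nonneg _) (by positivity)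
        _ = _ := by ring
    have ha : |ρ (‖v‖⁻¹ • v) - ρ (‖w‖⁻¹ • w)| ≤ K * (2 * K * (M * (K * M))) ^ μ * ‖h‖ ^ μ := by
      refine (hH _ _ ?_ ?_).trans ?_
      · rw [norm_smul, norm_inv, norm_norm, inv_mul_cancel₀ (norm_ne_zero_iff.2 hv)]
      · rw [norm_smul, norm_inv, norm_norm, inv_mul_cancel₀ (norm_ne_zero_iff.2 hw)]
      · rw [mul_assoc, ← Real.mul_rpow (by positivity) hhn]
        refine mul_le_mul_of_nonneg_left (Real.rpow_le_rpow (norm_nonneg _) ?_ hμ.1.le) hK.le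
        refine (unit_diff v w hv hw).trans ?_
        have hi : ‖v‖⁻¹ ≤ K := inv_le_of_inv_le₀ hK hv1
        calc 2 * ‖v‖⁻¹ * ‖v - w‖ ≤ 2 * K * (M * (K * M) * ‖h‖) := by gcongr
          _ = _ := by ring
    have hb : |(|(G (x + h)).det|⁻¹ - |(G x).det|⁻¹)| ≤ c0⁻¹ * c0⁻¹ * (L1 * K) * ‖h‖ ^ μ := by
      have p1 := hc0.trans_le (hdet (x + h))
      have p2 := hc0.trans_le (hdet x)
      have e : |(G (x + h)).det|⁻¹ - |(G x).det|⁻¹ =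
          |(G (x + h)).det|⁻¹ * |(G x).det|⁻¹ * (|(G x).det| - |(G (x + h)).det|) := by
        field_simp
      rw [e, abs_mul, abs_mul]
      have h3 : |(|(G x).det| - |(G (x + h)).det|)| ≤ L1 * (K * ‖h‖) := by
        rw [abs_sub_comm]
        refine (abs_abs_sub_abs_le_abs_sub _ _).trans ((hL1 _ _ (hG _) (hG _)).trans ?_)
        gcongr
      calc _ ≤ c0⁻¹ * c0⁻¹ * (L1 * (K * ‖h‖)) := by gcongr
        _ = c0⁻¹ * c0⁻¹ * (L1 * K) * ‖h‖ := by ring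
        _ ≤ _ := by gcongr
    have hc : |‖v‖ ^ (-((d : ℝ) + α)) - ‖w‖ ^ (-((d : ℝ) + α))| ≤
        L2 * (M * (K * M)) * ‖h‖ ^ μ := by
      calc _ ≤ L2 * |‖v‖ - ‖w‖| := hL2 _ _ ⟨hv1, hv2⟩ ⟨hw1, hw2⟩
        _ ≤ L2 * (M * (K * M) * ‖h‖) := by
            gcongr; exact (abs_norm_sub_norm_le v w).trans hvw
        _ = L2 * (M * (K * M)) * ‖h‖ := by ring
        _ ≤ _ := by gcongr
    refine (prod3_diff _ _ _ _ _ _ K c0⁻¹ (K ^ ((d : ℝ) + α)) _ _ _ hw5 hv5 hv6 hv7 hw6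
      ha hb hc).trans ?_
    have : 0 ≤ 6 * (K * c0⁻¹ * K ^ ((d : ℝ) + α)) * ‖h‖ ^ μ := by positivity
    linarith
  · have hpow : 1 ≤ ‖h‖ ^ μ := Real.one_le_rpow h1 hμ.1.le
    have two : ∀ s t b : ℝ, |s| ≤ b → |t| ≤ b → |s - t| ≤ 2 * b := fun s t b hs ht =>
      (abs_sub s t).trans (by linarith)
    refine (prod3_diff _ _ _ _ _ _ K c0⁻¹ (K ^ ((d : ℝ) + α)) _ _ _ hw5 hv5 hv6 hv7 hw6
      (two _ _ _ hv5 hw5) (two _ _ _ hv6 hw6) (two _ _ _ hv7 hw7)).trans ?_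
    calc _ = 6 * (K * c0⁻¹ * K ^ ((d : ℝ) + α)) * 1 := by ring
      _ ≤ _ := by
        gcongr
        have : 0 ≤ K * (2 * K * (M * (K * M))) ^ μ * c0⁻¹ * K ^ ((d : ℝ) + α)
          + K * (c0⁻¹ * c0⁻¹ * (L1 * K)) * K ^ ((d : ℝ) + α)
          + K * c0⁻¹ * (L2 * (M * (K * M))) := by positivity
        linarith
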